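/- Fix n, m ∈ ℕ with m ≤ n. Let G : ℝⁿ → (real n×m matrices) have rank m at every q, and let G^⊥ : ℝⁿ → (real (n−m)×n matrices) have rank n−m at every q with G^⊥(q) G(q) = 0. Let H, Ĥ : ℝⁿ × ℝⁿ → ℝ be differentiable, let M, M̂ : ℝⁿ → (real symmetric positive definite n×n matrices), Kᵥ : ℝⁿ → (real m×m matrices), and let F_gyro : ℝⁿ × ℝⁿ → ℝⁿ be any map. Define F(q,p) = ∂_qH(q,p) − M̂(q)M(q)⁻¹ ∂_qĤ(q,p) + F_gyro(q,p). If G^⊥(q) F(q,p) = 0 for all (q,p), then the feedback u(q,p) = (G(q)ᵀG(q))⁻¹ G(q)ᵀ (F(q,p) − G(q) Kᵥ(q) G(q)ᵀ ∂ₚĤ(q,p)) satisfies, for all (q,p): −∂_qH(q,p) + G(q) u(q,p) = −M̂(q)M(q)⁻¹ ∂_qĤ(q,p) − G(q) Kᵥ(q) G(q)ᵀ ∂ₚĤ(q,p) + F_gyro(q,p). -/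

import Mathlib

open Matrix

/-- The gradient with respect to the first (position) argument of a function
`H : ℝⁿ × ℝⁿ → ℝ`. -/
noncomputable def gradQ (n : ℕ) (H : (Fin n → ℝ) → (Fin n → ℝ) → ℝ)
    (q p : Fin n → ℝ) : Fin n → ℝ :=
  fun k => fderiv ℝ (fun q' => H q' p) q (Pi.single k 1)

/-- The gradient with respect to the second (momentum) argument of a function
`H : ℝⁿ × ℝⁿ → ℝ`. -/
noncomputable def gradP (n : ℕ) (H : (Fin n → ℝ) → (Fin n → ℝ) → ℝ)
    (q p : Fin n → ℝ) : Fin n → ℝ :=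
  fun k => fderiv ℝ (fun p' => H q p') p (Pi.single k 1)

/-- If `B * A = 0` and the ranks of `A` and `B` add up to the middle dimension, then the
kernel of `B` is the column space of `A`. -/
theorem ker_mulVecLin_eq_range_of_mul_eq_zero {K l m n : Type*} [Field K] [Fintype l]
    [Fintype m] [Fintype n] {A : Matrix n m K} {B : Matrix l n K} (hBA : B * A = 0)
    (hrank : A.rank + B.rank = Fintype.card n) :
    LinearMap.ker B.mulVecLin = LinearMap.range A.mulVecLin := by
  symm
  apply Submodule.eq_of_le_of_finrank_eq
  · rintro _ ⟨v, rfl⟩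
    simp [hBA]
  · have h := B.mulVecLin.finrank_range_add_finrank_ker
    rw [Module.finrank_fintype_fun_eq_card] at h
    simp only [Matrix.rank] at hrank
    lia

/-- The Gram matrix of a real matrix of full column rank is invertible. -/
theorem isUnit_transpose_mul_self_of_rank_eq {m n : Type*} [Fintype m] [DecidableEq m]
    [Fintype n] {A : Matrix n m ℝ} (hA : A.rank = Fintype.card m) : IsUnit (Aᵀ * A) := by
  rw [← Matrix.mulVec_surjective_iff_isUnit]
  change Function.Surjective (Aᵀ * A).mulVecLin
  rw [← LinearMap.range_eq_top]
  apply Submodule.eq_top_of_finrank_eq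
  rw [Module.finrank_fintype_fun_eq_card, ← hA]
  exact Matrix.rank_transpose_mul_self A

/-- The map `A (AᵀA)⁻¹ Aᵀ` fixes the column space of `A`. -/
theorem mulVec_gram_inv_mulVec_transpose_of_mem_range {m n : Type*} [Fintype m]
    [DecidableEq m] [Fintype n] {A : Matrix n m ℝ} (hA : A.rank = Fintype.card m)
    {x : n → ℝ} (hx : x ∈ LinearMap.range A.mulVecLin) :
    A *ᵥ ((Aᵀ * A)⁻¹ *ᵥ (Aᵀ *ᵥ x)) = x := by
  obtain ⟨v, rfl⟩ := hx
  have hdet := (Matrix.isUnit_iff_isUnit_det _).mp (isUnit_transpose_mul_self_of_rank_eq hA)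
  rw [Matrix.mulVecLin_apply, Matrix.mulVec_mulVec v Aᵀ A, Matrix.mulVec_mulVec v,
    Matrix.nonsing_inv_mul _ hdet, Matrix.one_mulVec]

/-- The IDA-PBC feedback: if `G(q)` has full rank `m`, `G^⊥(q)` is a full-rank left
annihilator of `G(q)`, and the matching condition `G^⊥(q) F(q,p) = 0` holds for
`F = ∂_qH − M̂M⁻¹∂_qĤ + F_gyro`, then the feedback
`u = (GᵀG)⁻¹Gᵀ(F − GKᵥGᵀ∂ₚĤ)` transforms the `ṗ`-equation of the original system
into the desired closed-loop form:
`−∂_qH + Gu = −M̂M⁻¹∂_qĤ − GKᵥGᵀ∂ₚĤ + F_gyro`. -/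
theorem stmt_13 (n m : ℕ) (hmn : m ≤ n)
    (G : (Fin n → ℝ) → Matrix (Fin n) (Fin m) ℝ)
    (hG : ∀ q, (G q).rank = m)
    (Gperp : (Fin n → ℝ) → Matrix (Fin (n - m)) (Fin n) ℝ)
    (hGperp : ∀ q, (Gperp q).rank = n - m)
    (hGperpG : ∀ q, Gperp q * G q = 0)
    (H Hhat : (Fin n → ℝ) → (Fin n → ℝ) → ℝ)
    (hH : Differentiable ℝ fun x : (Fin n → ℝ) × (Fin n → ℝ) => H x.1 x.2)
    (hHhat : Differentiable ℝ fun x : (Fin n → ℝ) × (Fin n → ℝ) => Hhat x.1 x.2)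
    (M Mhat : (Fin n → ℝ) → Matrix (Fin n) (Fin n) ℝ)
    (hMpos : ∀ q, (M q).PosDef) (hMsym : ∀ q, (M q).IsSymm)
    (hMhatpos : ∀ q, (Mhat q).PosDef) (hMhatsym : ∀ q, (Mhat q).IsSymm)
    (Kv : (Fin n → ℝ) → Matrix (Fin m) (Fin m) ℝ)
    (Fgyro : (Fin n → ℝ) → (Fin n → ℝ) → Fin n → ℝ)
    (F : (Fin n → ℝ) → (Fin n → ℝ) → Fin n → ℝ)
    (hF : ∀ q p, F q p =
      gradQ n H q p - (Mhat q * (M q)⁻¹) *ᵥ gradQ n Hhat q p + Fgyro q p)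
    (hmatch : ∀ q p, Gperp q *ᵥ F q p = 0)
    (u : (Fin n → ℝ) → (Fin n → ℝ) → Fin m → ℝ)
    (hu : ∀ q p, u q p = ((G q)ᵀ * G q)⁻¹ *ᵥ ((G q)ᵀ *ᵥ
      (F q p - (G q * Kv q * (G q)ᵀ) *ᵥ gradP n Hhat q p))) :
    ∀ q p : Fin n → ℝ,
      -gradQ n H q p + G q *ᵥ u q p =
        -((Mhat q * (M q)⁻¹) *ᵥ gradQ n Hhat q p)
          - (G q * Kv q * (G q)ᵀ) *ᵥ gradP n Hhat q p + Fgyro q p := by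
  intro q p
  have hFmem : F q p ∈ LinearMap.range (G q).mulVecLin := by
    rw [← ker_mulVecLin_eq_range_of_mul_eq_zero (hGperpG q)
      (by rw [hG, hGperp, Fintype.card_fin]; lia)]
    exact hmatch q p
  have hDmem : (G q * Kv q * (G q)ᵀ) *ᵥ gradP n Hhat q p ∈ LinearMap.range (G q).mulVecLin :=
    ⟨(Kv q * (G q)ᵀ) *ᵥ gradP n Hhat q p, by simp [Matrix.mul_assoc]⟩
  rw [hu, mulVec_gram_inv_mulVec_transpose_of_mem_range (by rw [hG, Fintype.card_fin])
    (Submodule.sub_mem _ hFmem hDmem), hF]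
  abel
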